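/- For every n ≥ 2 and all P, Q ∈ Γ_n, one has (1/16)·Ψ(P‖Q) − h(P‖Q) ≤ (9/8)·[(1/16)·Ψ(P‖Q) − (1/8)·J(P‖Q)]. -/

import Mathlib

open Real BigOperators

noncomputable def triangularD {n : ℕ} (p q : Fin n → ℝ) : ℝ :=
  ∑ i, (p i - q i) ^ 2 / (p i + q i)

noncomputable def hellingerD {n : ℕ} (p q : Fin n → ℝ) : ℝ :=
  (1 / 2) * ∑ i, (Real.sqrt (p i) - Real.sqrt (q i)) ^ 2

noncomputable def symChiSqD {n : ℕ} (p q : Fin n → ℝ) : ℝ :=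
  ∑ i, (p i - q i) ^ 2 * (p i + q i) / (p i * q i)

noncomputable def jDiv {n : ℕ} (p q : Fin n → ℝ) : ℝ :=
  ∑ i, (p i - q i) * Real.log (p i / q i)

noncomputable def jsDiv {n : ℕ} (p q : Fin n → ℝ) : ℝ :=
  (1 / 2) * ((∑ i, p i * Real.log (2 * p i / (p i + q i))) +
    (∑ i, q i * Real.log (2 * q i / (p i + q i))))

noncomputable def agDiv {n : ℕ} (p q : Fin n → ℝ) : ℝ :=
  ∑ i, ((p i + q i) / 2) * Real.log ((p i + q i) / (2 * Real.sqrt (p i * q i)))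

noncomputable def dStar {n : ℕ} (p q : Fin n → ℝ) : ℝ :=
  ∑ i, (p i - q i) ^ 4 / Real.sqrt ((p i * q i) ^ 3)

lemma aux_mono : MonotoneOn (fun x : ℝ => x ^ 2 - (x ^ 2)⁻¹ + 64 * ((x - 1) / (x + 1)) - 36 * Real.log x)
    (Set.Ioi 0) := by
  have hd : ∀ x : ℝ, 0 < x → HasDerivAt
      (fun x : ℝ => x ^ 2 - (x ^ 2)⁻¹ + 64 * ((x - 1) / (x + 1)) - 36 * Real.log x)
      (2 * (x - 1) ^ 4 * (x ^ 2 + 6 * x + 1) / (x ^ 3 * (x + 1) ^ 2)) x := by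
    intro x hx
    have h2 : HasDerivAt (fun x : ℝ => x ^ 2) (2 * x) x := by
      simpa using hasDerivAt_pow 2 x
    have h3 := h2.fun_inv (by positivity)
    have h4 := ((hasDerivAt_id' x).sub_const 1).fun_div ((hasDerivAt_id' x).add_const 1)
      (by positivity)
    have h5 := Real.hasDerivAt_log hx.ne'
    have h6 := ((h2.fun_sub h3).fun_add (h4.const_mul 64)).fun_sub (h5.const_mul 36)
    refine h6.congr_deriv ?_
    have : x + 1 ≠ 0 := by positivity
    field_simp
    ring
  apply monotoneOn_of_deriv_nonneg (convex_Ioi 0)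
  · intro x hx
    exact (hd x hx).continuousAt.continuousWithinAt
  · intro x hx
    rw [interior_Ioi] at hx
    exact (hd x hx).differentiableAt.differentiableWithinAt
  · intro x hx
    rw [interior_Ioi] at hx
    rw [(hd x hx).deriv]
    have : 0 < x := hx
    positivity

lemma aux_x (x : ℝ) (hx : 0 < x) :
    0 ≤ (x ^ 2 - 1) * (x ^ 2 - (x ^ 2)⁻¹ + 64 * ((x - 1) / (x + 1)) - 36 * Real.log x) := by
  rcases le_total 1 x with h | h
  · have := aux_mono (Set.mem_Ioi.2 one_pos) (Set.mem_Ioi.2 hx) h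
    norm_num at this
    exact mul_nonneg (by nlinarith) (by linarith)
  · have := aux_mono (Set.mem_Ioi.2 hx) (Set.mem_Ioi.2 one_pos) h
    norm_num at this
    exact mul_nonneg_of_nonpos_of_nonpos (by nlinarith) (by linarith)

lemma aux_term (p q : ℝ) (hp : 0 < p) (hq : 0 < q) :
    0 ≤ (p - q) ^ 2 * (p + q) / (p * q) + 64 * (Real.sqrt p - Real.sqrt q) ^ 2
      - 18 * ((p - q) * Real.log (p / q)) := by
  obtain ⟨a, ha, rfl⟩ : ∃ a : ℝ, 0 < a ∧ p = a ^ 2 :=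
    ⟨√p, Real.sqrt_pos.2 hp, (Real.sq_sqrt hp.le).symm⟩
  obtain ⟨b, hb, rfl⟩ : ∃ b : ℝ, 0 < b ∧ q = b ^ 2 :=
    ⟨√q, Real.sqrt_pos.2 hq, (Real.sq_sqrt hq.le).symm⟩
  rw [Real.sqrt_sq ha.le, Real.sqrt_sq hb.le, ← div_pow, Real.log_pow]
  have h := mul_nonneg (sq_nonneg b) (aux_x (a / b) (by positivity))
  generalize Real.log (a / b) = L at *
  refine h.trans_eq ?_
  have : a + b ≠ 0 := by positivity
  have : a / b + 1 ≠ 0 := by positivity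
  push_cast
  field_simp
  ring

theorem stmt_17 (n : ℕ) (hn : 2 ≤ n) (p q : Fin n → ℝ)
    (hp : ∀ i, 0 < p i) (hq : ∀ i, 0 < q i)
    (hps : ∑ i, p i = 1) (hqs : ∑ i, q i = 1) :
    (1 / 16) * symChiSqD p q - hellingerD p q ≤ (9 / 8) * ((1 / 16) * symChiSqD p q - (1 / 8) * jDiv p q) := by
  have h := Finset.sum_nonneg (fun i (_ : i ∈ Finset.univ) => aux_term (p i) (q i) (hp i) (hq i))
  rw [Finset.sum_sub_distrib, Finset.sum_add_distrib, ← Finset.mul_sum, ← Finset.mul_sum] at h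
  unfold symChiSqD hellingerD jDiv
  linarith
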